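/- For every subsets D_1 ⊆ [n-1] and D_2 ⊆ [n], the reverse major index and the length are equi-distributed over {π ∈ S_n : Des_S(π^{-1}) ⊆ D_1 and Del_S(π^{-1}) ⊆ D_2}: Σ q^{rmaj_{S_n}(π)} = Σ q^{ℓ_S(π)} over this set. -/

import Mathlib

open scoped Classical
open Finset

noncomputable section

/-- `sgen n i` is the adjacent transposition `s_i = (i, i+1)` (1-indexed) in `S_n`,
realized as a permutation of `Fin n` (positions `1,…,n` correspond to `0,…,n-1`). -/
def sgen (n i : ℕ) : Equiv.Perm (Fin n) :=
  if h : 1 ≤ i ∧ i < n then Equiv.swap ⟨i - 1, by omega⟩ ⟨i, h.2⟩ else 1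

/-- `agen n i` is the generator `a_i = s_1 s_{i+1}` of the alternating group. -/
def agen (n i : ℕ) : Equiv.Perm (Fin n) := sgen n 1 * sgen n (i + 1)

/-- The descending product `s_j s_{j-1} ⋯ s_k` (equal to `1` when `k = j+1`). -/
def dProd (n j k : ℕ) : Equiv.Perm (Fin n) :=
  ((List.range (j + 1 - k)).map fun t => sgen n (j - t)).prod

/-- The descending product `a_j a_{j-1} ⋯ a_k` (equal to `1` when `k = j+1`). -/
def aDProd (n j k : ℕ) : Equiv.Perm (Fin n) :=
  ((List.range (j + 1 - k)).map fun t => agen n (j - t)).prod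

/-- `R^S_j = {1, s_j, s_j s_{j-1}, …, s_j s_{j-1} ⋯ s_1}`. -/
def RS (n j : ℕ) : Set (Equiv.Perm (Fin n)) :=
  { w | ∃ k, 1 ≤ k ∧ k ≤ j + 1 ∧ w = dProd n j k }

/-- `R^S_j` as a finite set. -/
def RSfin (n j : ℕ) : Finset (Equiv.Perm (Fin n)) :=
  (Finset.range (j + 1)).image fun k => dProd n j (k + 1)

/-- `R^A_j = {1, a_j, a_j a_{j-1}, …, a_j ⋯ a_2, a_j ⋯ a_2 a_1, a_j ⋯ a_2 a_1⁻¹}`. -/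
def RA (n j : ℕ) : Set (Equiv.Perm (Fin n)) :=
  { v | (∃ k, 1 ≤ k ∧ k ≤ j + 1 ∧ v = aDProd n j k) ∨ v = aDProd n j 2 * (agen n 1)⁻¹ }

/-- The element of `R^A_j` with code `k`:
`k = 0` encodes `a_j ⋯ a_2 a_1⁻¹`, and `k ≥ 1` encodes `a_j ⋯ a_k`. -/
def elemA (n j k : ℕ) : Equiv.Perm (Fin n) :=
  if k = 0 then aDProd n j 2 * (agen n 1)⁻¹ else aDProd n j k

/-- `k : Fin (n-1) → ℕ` codes the S-canonical presentation of `w`: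
the `j`-th factor is `s_{j+1} s_j ⋯ s_{k j} ∈ R^S_{j+1}` (`k j = j + 2` codes `1`). -/
def isCanonS (n : ℕ) (w : Equiv.Perm (Fin n)) (k : Fin (n - 1) → ℕ) : Prop :=
  (∀ j : Fin (n - 1), 1 ≤ k j ∧ k j ≤ (j : ℕ) + 2) ∧
    (List.ofFn fun j : Fin (n - 1) => dProd n ((j : ℕ) + 1) (k j)).prod = w

/-- The code of the S-canonical presentation of `w` (it is unique when it exists). -/
def kvecS (n : ℕ) (w : Equiv.Perm (Fin n)) : Fin (n - 1) → ℕ :=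
  if h : ∃ k, isCanonS n w k then h.choose else fun _ => 0

/-- `del_S w` : the number of occurrences of `s_1` in the S-canonical presentation of `w`
(the factor from `R^S_{j+1}` contains `s_1` exactly when its code is `1`). -/
def delS (n : ℕ) (w : Equiv.Perm (Fin n)) : ℕ :=
  (Finset.univ.filter fun j : Fin (n - 1) => kvecS n w j = 1).card

/-- `k : Fin (m-2) → ℕ` codes the A-canonical presentation of `v ∈ A_m`:
the `j`-th factor is `elemA m (j+1) (k j) ∈ R^A_{j+1}`. -/
def isCanonA (m : ℕ) (v : Equiv.Perm (Fin m)) (k : Fin (m - 2) → ℕ) : Prop :=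
  (∀ j : Fin (m - 2), k j ≤ (j : ℕ) + 2) ∧
    (List.ofFn fun j : Fin (m - 2) => elemA m ((j : ℕ) + 1) (k j)).prod = v

/-- The code of the A-canonical presentation of `v`. -/
def kvecA (m : ℕ) (v : Equiv.Perm (Fin m)) : Fin (m - 2) → ℕ :=
  if h : ∃ k, isCanonA m v k then h.choose else fun _ => 0

/-- `del_A v` : the number of occurrences of `a_1^{±1}` in the A-canonical presentation
(codes `0` and `1` are the two factors containing `a_1^{±1}`). -/
def delA (m : ℕ) (v : Equiv.Perm (Fin m)) : ℕ :=
  (Finset.univ.filter fun j : Fin (m - 2) => kvecA m v j ≤ 1).card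

/-- `ℓ_A v` : the total number of letters `a_i^{±1}` in the A-canonical presentation:
the factor of `R^A_{j+1}` with code `0` has `j+1` letters, the one with code `k ≥ 1`
has `j + 2 - k` letters. -/
def lenA (m : ℕ) (v : Equiv.Perm (Fin m)) : ℕ :=
  ∑ j : Fin (m - 2), if kvecA m v j = 0 then (j : ℕ) + 1 else (j : ℕ) + 2 - kvecA m v j

/-- `ℓ_S w` : the number of inversions of `w`. -/
def invS {n : ℕ} (w : Equiv.Perm (Fin n)) : ℕ :=
  (Finset.univ.filter fun p : Fin n × Fin n => p.1 < p.2 ∧ w p.2 < w p.1).card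

/-- The (1-indexed) descent set `Des_S(σ) = {1 ≤ i ≤ n-1 : σ(i) > σ(i+1)}`. -/
def Des1 {n : ℕ} (σ : Equiv.Perm (Fin n)) : Finset ℕ :=
  (Finset.Ico 1 n).filter fun i => ∃ h : i < n, σ ⟨i, h⟩ < σ ⟨i - 1, by omega⟩

/-- `rmaj_{S_m}(σ) = ∑_{i ∈ Des_S(σ)} (m - i)`. -/
def rmaj1 {n : ℕ} (m : ℕ) (σ : Equiv.Perm (Fin n)) : ℕ := ∑ i ∈ Des1 σ, (m - i)

/-- `maj_S(σ) = ∑_{i ∈ Des_S(σ)} i`. -/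
def maj1 {n : ℕ} (σ : Equiv.Perm (Fin n)) : ℕ := ∑ i ∈ Des1 σ, i

/-- `Del_S(σ)` : the (1-indexed) positions `1 < i ≤ n` which are left-to-right minima:
`σ(i) < σ(j)` for all `j < i`. -/
def DelSet {n : ℕ} (σ : Equiv.Perm (Fin n)) : Finset ℕ :=
  (Finset.Icc 2 n).filter fun i =>
    ∃ h : i - 1 < n, ∀ j : Fin n, (j : ℕ) < i - 1 → σ ⟨i - 1, h⟩ < σ j

/-- `del_S(σ)` computed combinatorially: the number of left-to-right minima of `σ`
other than the first position. -/
def delC {n : ℕ} (σ : Equiv.Perm (Fin n)) : ℕ := (DelSet σ).card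

/-- The Gaussian (q-)binomial coefficient, via the q-Pascal recursion. -/
def qbinom {R : Type*} [CommRing R] (q : R) : ℕ → ℕ → R
  | _, 0 => 1
  | 0, _ + 1 => 0
  | n + 1, k + 1 => qbinom q n k + q ^ (k + 1) * qbinom q n (k + 1)

end

/-- The reverse major index of a word: the sum of `length - i` over the descents `i`. -/
def wordRmaj : List ℕ → ℕ
  | [] => 0
  | [_] => 0
  | x :: y :: l => (if y < x then l.length + 1 else 0) + wordRmaj (y :: l)

/-- The inversion number of a word. -/
def wordInv : List ℕ → ℕ
  | [] => 0
  | x :: l => l.countP (fun y => decide (y < x)) + wordInv l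

/-- The set of all shuffles of two words. -/
def shuffles : List ℕ → List ℕ → Finset (List ℕ)
  | [], b => {b}
  | x :: w, [] => {x :: w}
  | x :: w, y :: b =>
      (shuffles w (y :: b)).image (List.cons x) ∪ (shuffles (x :: w) b).image (List.cons y)
  termination_by w b => w.length + b.length

/-- The Gaussian binomial coefficient `[m + k choose k]`. -/
def gauss {R : Type*} [CommRing R] (q : R) : ℕ → ℕ → R
  | 0, _ => 1
  | _ + 1, 0 => 1
  | m + 1, k + 1 => gauss q (m + 1) k + q ^ (k + 1) * gauss q m (k + 1)
  termination_by m k => m + k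

section Gauss

variable {R : Type*} [CommRing R] (q : R)

theorem gauss_zero_left (k : ℕ) : gauss q 0 k = 1 := by
  rw [gauss]

theorem gauss_zero_right (m : ℕ) : gauss q m 0 = 1 := by
  cases m <;> rw [gauss]

theorem gauss_succ_succ (m k : ℕ) :
    gauss q (m + 1) (k + 1) = gauss q (m + 1) k + q ^ (k + 1) * gauss q m (k + 1) := by
  rw [gauss]

theorem gauss_succ_succ' (m k : ℕ) :
    gauss q (m + 1) (k + 1) = gauss q m (k + 1) + q ^ (m + 1) * gauss q (m + 1) k := by
  induction m generalizing k with
  | zero =>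
    induction k with
    | zero => simp [gauss_succ_succ, gauss_zero_left, gauss_zero_right]
    | succ k ih =>
      rw [gauss_succ_succ, ih]
      rw [gauss_succ_succ] at ih
      simp only [gauss_zero_left] at ih ⊢
      linear_combination q * ih
  | succ m ihm =>
    induction k with
    | zero =>
      have h := ihm 0
      rw [gauss_succ_succ] at h ⊢
      simp only [gauss_zero_right] at h ⊢
      linear_combination (q - 1) * gauss_succ_succ q m 0 + q * h +
        (q - 1) * gauss_zero_right q (m + 1)
    | succ k ihk =>
      have h1 := gauss_succ_succ q (m + 1) (k + 1)
      have h2 := gauss_succ_succ q (m + 1) k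
      have h3 := gauss_succ_succ q m (k + 1)
      have h4 := ihm (k + 1)
      linear_combination h1 + ihk - h3 + q ^ (k + 2) * h4 - q ^ (m + 2) * h2

end Gauss

section Shuffles

theorem shuffles_nil_left (b : List ℕ) : shuffles [] b = {b} := by
  rw [shuffles]

theorem shuffles_nil_right (w : List ℕ) : shuffles w [] = {w} := by
  cases w <;> rw [shuffles]

theorem mem_shuffles_iff (p : ℕ → Bool) (v w b : List ℕ) (hw : ∀ x ∈ w, p x = true)
    (hb : ∀ y ∈ b, p y = false) :
    v ∈ shuffles w b ↔ v.filter p = w ∧ v.filter (fun x => !p x) = b := by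
  induction v generalizing w b with
  | nil =>
    rcases w with _ | ⟨x, w⟩ <;> rcases b with _ | ⟨y, b⟩ <;> simp [shuffles]
  | cons z v ih =>
    rcases w with _ | ⟨x, w⟩
    · rw [shuffles_nil_left, Finset.mem_singleton]
      constructor
      · rintro rfl
        refine ⟨?_, ?_⟩
        · rw [List.filter_eq_nil_iff]
          intro a ha
          simp [hb a ha]
        · rw [List.filter_eq_self]
          intro a ha
          simp [hb a ha]
      · rintro ⟨h1, h2⟩
        rw [List.filter_eq_nil_iff] at h1
        rw [← h2, eq_comm, List.filter_eq_self]
        intro a ha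
        simpa using h1 a ha
    · rcases b with _ | ⟨y, b⟩
      · rw [shuffles_nil_right, Finset.mem_singleton]
        constructor
        · intro h
          rw [h]
          refine ⟨?_, ?_⟩
          · rw [List.filter_eq_self]
            exact hw
          · rw [List.filter_eq_nil_iff]
            intro a ha
            simp [hw a ha]
        · rintro ⟨h1, h2⟩
          rw [List.filter_eq_nil_iff] at h2
          rw [← h1, eq_comm, List.filter_eq_self]
          intro a ha
          simpa using h2 a ha
      · have i1 := ih w (y :: b) (fun a ha => hw a (List.mem_cons_of_mem _ ha)) hb
        have i2 := ih (x :: w) b hw (fun a ha => hb a (List.mem_cons_of_mem _ ha))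
        have hx : p x = true := hw x (by simp)
        have hy : p y = false := hb y (by simp)
        rw [shuffles, Finset.mem_union, Finset.mem_image, Finset.mem_image]
        simp only [List.cons.injEq, exists_eq_right_right, i1, i2]
        cases hz : p z
        · have : x ≠ z := by rintro rfl; simp_all
          simp only [List.filter_cons, hz]
          simp only [this, and_false, false_or, Bool.not_false, if_true, Bool.false_eq_true,
            if_false, List.cons.injEq]
          tauto
        · have : y ≠ z := by rintro rfl; simp_all
          simp only [List.filter_cons, hz]
          simp only [this, and_false, or_false, Bool.not_true, if_true, Bool.false_eq_true,
            if_false, List.cons.injEq]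
          tauto

theorem perm_of_mem_shuffles {v w b : List ℕ} (h : v ∈ shuffles w b) : v.Perm (w ++ b) := by
  induction v generalizing w b with
  | nil => rcases w with _ | ⟨x, w⟩ <;> rcases b with _ | ⟨y, b⟩ <;> simp_all [shuffles]
  | cons z v ih =>
    rcases w with _ | ⟨x, w⟩
    · simp_all [shuffles]
    · rcases b with _ | ⟨y, b⟩
      · simp_all [shuffles]
      · rw [shuffles, Finset.mem_union, Finset.mem_image, Finset.mem_image] at h
        simp only [List.cons.injEq, exists_eq_right_right] at h
        rcases h with ⟨h, rfl⟩ | ⟨h, rfl⟩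
        · exact (ih h).cons x
        · exact ((ih h).cons y).trans List.perm_middle.symm

theorem sum_shuffles_cons_cons {M : Type*} [AddCommMonoid M] (f : List ℕ → M) {x y : ℕ}
    (hxy : x < y) (w b : List ℕ) :
    ∑ v ∈ shuffles (x :: w) (y :: b), f v =
      ∑ v ∈ shuffles w (y :: b), f (x :: v) + ∑ v ∈ shuffles (x :: w) b, f (y :: v) := by
  rw [shuffles, Finset.sum_union, Finset.sum_image, Finset.sum_image]
  · intro a _ c _ h
    exact List.cons_injective h
  · intro a _ c _ h
    exact List.cons_injective h
  · rw [Finset.disjoint_left]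
    intro v h1 h2
    simp only [Finset.mem_image] at h1 h2
    obtain ⟨a, -, rfl⟩ := h1
    obtain ⟨c, -, h⟩ := h2
    simp only [List.cons.injEq] at h
    omega

theorem wordRmaj_eq_zero {l : List ℕ} (h : l.Pairwise (· < ·)) : wordRmaj l = 0 := by
  induction l with
  | nil => rfl
  | cons x l ih =>
    rcases l with _ | ⟨y, l⟩
    · rfl
    · have h1 := ih h.of_cons
      have : x < y := List.rel_of_pairwise_cons h (by simp)
      rw [wordRmaj, h1, if_neg (by omega)]

theorem wordInv_eq_zero {l : List ℕ} (h : l.Pairwise (· < ·)) : wordInv l = 0 := by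
  induction l with
  | nil => rfl
  | cons x l ih =>
    rw [wordInv, ih h.of_cons, Nat.add_zero, List.countP_eq_zero]
    intro a ha
    have : x < a := List.rel_of_pairwise_cons h ha
    simp only [decide_eq_true_eq]
    omega

variable {R : Type*} [CommRing R] (q : R)

theorem sum_wordInv_shuffles (w b : List ℕ) (hb : b.Pairwise (· < ·))
    (hwb : ∀ x ∈ w, ∀ y ∈ b, x < y) :
    ∑ v ∈ shuffles w b, q ^ wordInv v = q ^ wordInv w * gauss q w.length b.length := by
  induction w generalizing b with
  | nil => simp [shuffles_nil_left, gauss_zero_left, wordInv_eq_zero hb, wordInv]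
  | cons x w ihw =>
    induction b with
    | nil => simp [shuffles_nil_right, gauss_zero_right]
    | cons y b ihb =>
      have hxy : x < y := hwb x (by simp) y (by simp)
      rw [sum_shuffles_cons_cons _ hxy]
      have h1 : ∀ v ∈ shuffles w (y :: b), q ^ wordInv (x :: v) =
          q ^ w.countP (fun z => decide (z < x)) * q ^ wordInv v := by
        intro v hv
        rw [wordInv, pow_add, (perm_of_mem_shuffles hv).countP_eq, List.countP_append,
          (List.countP_eq_zero (l := y :: b)).2, Nat.add_zero]
        intro z hz
        have := hwb x (by simp) z hz
        simp only [decide_eq_true_eq]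
        omega
      have h2 : ∀ v ∈ shuffles (x :: w) b, q ^ wordInv (y :: v) =
          q ^ (x :: w).length * q ^ wordInv v := by
        intro v hv
        rw [wordInv, pow_add, (perm_of_mem_shuffles hv).countP_eq, List.countP_append,
          (List.countP_eq_zero (l := b)).2, Nat.add_zero, List.countP_eq_length.2]
        · intro z hz
          simpa using hwb z hz y (by simp)
        · intro z hz
          have : y < z := List.rel_of_pairwise_cons hb hz
          simp only [decide_eq_true_eq]
          omega
      rw [Finset.sum_congr rfl h1, Finset.sum_congr rfl h2, ← Finset.mul_sum, ← Finset.mul_sum,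
        ihw (y :: b) hb (fun z hz => hwb z (List.mem_cons_of_mem _ hz)),
        ihb hb.of_cons (fun z hz a ha => hwb z hz a (List.mem_cons_of_mem _ ha))]
      simp only [List.length_cons, gauss_succ_succ', wordInv, pow_add]
      ring

theorem length_of_mem_shuffles {v w b : List ℕ} (h : v ∈ shuffles w b) :
    v.length = w.length + b.length := by
  rw [(perm_of_mem_shuffles h).length_eq, List.length_append]

theorem wordRmaj_cons_of_forall_lt {y : ℕ} {w : List ℕ} (h : ∀ x ∈ w, x < y) :
    wordRmaj (y :: w) = w.length + wordRmaj w := by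
  rcases w with _ | ⟨x, w⟩
  · rfl
  · rw [wordRmaj, if_pos (h x (by simp)), List.length_cons]

theorem sum_wordRmaj_cons_shuffles (w b : List ℕ) (hb : b.Pairwise (· < ·))
    (hwb : ∀ x ∈ w, ∀ y ∈ b, x < y) :
    (∀ y, (∀ x ∈ w, x < y) → (∀ z ∈ b, y < z) → ∑ v ∈ shuffles w b, q ^ wordRmaj (y :: v) =
      q ^ (w.length + wordRmaj w) * gauss q w.length b.length) ∧
    (∀ x, (∀ z ∈ b, x < z) → ∑ v ∈ shuffles w b, q ^ wordRmaj (x :: v) =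
      q ^ wordRmaj (x :: w) * gauss q w.length b.length) := by
  induction w generalizing b with
  | nil =>
    have key : ∀ x, (∀ z ∈ b, x < z) → wordRmaj (x :: b) = 0 := fun x hx =>
      wordRmaj_eq_zero (List.pairwise_cons.2 ⟨hx, hb⟩)
    refine ⟨fun y _ hy => ?_, fun x hx => ?_⟩
    · simp [shuffles_nil_left, gauss_zero_left, key y hy, wordRmaj]
    · simp [shuffles_nil_left, gauss_zero_left, key x hx, wordRmaj]
  | cons x' w ihw =>
    induction b with
    | nil =>
      refine ⟨fun y hy _ => ?_, fun x hx => ?_⟩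
      · rw [shuffles_nil_right, Finset.sum_singleton, wordRmaj_cons_of_forall_lt hy]
        simp [gauss_zero_right]
      · simp [shuffles_nil_right, gauss_zero_right]
    | cons y' b ihb =>
      have hxy : x' < y' := hwb x' (by simp) y' (by simp)
      have H2 := (ihw (y' :: b) hb (fun z hz => hwb z (List.mem_cons_of_mem _ hz))).2 x'
        (hwb x' (by simp))
      have H1 := (ihb hb.of_cons (fun z hz a ha => hwb z hz a (List.mem_cons_of_mem _ ha))).1 y'
        (fun z hz => hwb z hz y' (by simp)) (fun z hz => List.rel_of_pairwise_cons hb hz)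
      have small : ∀ z, ∀ v ∈ shuffles w (y' :: b), q ^ wordRmaj (z :: x' :: v) =
          q ^ (if x' < z then w.length + b.length + 2 else 0) * q ^ wordRmaj (x' :: v) := by
        intro z v hv
        rw [wordRmaj, length_of_mem_shuffles hv, pow_add, List.length_cons]
        rfl
      have large : ∀ z, z < y' → ∀ v ∈ shuffles (x' :: w) b, q ^ wordRmaj (z :: y' :: v) =
          q ^ wordRmaj (y' :: v) := by
        intro z hz v hv
        rw [wordRmaj, if_neg (by omega), Nat.zero_add]
      refine ⟨fun y hy hy' => ?_, fun x hx => ?_⟩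
      · rw [sum_shuffles_cons_cons _ hxy, Finset.sum_congr rfl (small y),
          Finset.sum_congr rfl (large y (hy' y' (by simp))), ← Finset.mul_sum, H1, H2,
          if_pos (hy x' (by simp))]
        simp only [List.length_cons, gauss_succ_succ, pow_add]
        ring
      · rw [sum_shuffles_cons_cons _ hxy, Finset.sum_congr rfl (small x),
          Finset.sum_congr rfl (large x (hx y' (by simp))), ← Finset.mul_sum, H1, H2,
          wordRmaj]
        split_ifs
        · simp only [List.length_cons, gauss_succ_succ, pow_add]
          ring
        · simp only [List.length_cons, gauss_succ_succ', pow_add]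
          ring

theorem sum_wordRmaj_shuffles (w b : List ℕ) (hb : b.Pairwise (· < ·))
    (hwb : ∀ x ∈ w, ∀ y ∈ b, x < y) :
    ∑ v ∈ shuffles w b, q ^ wordRmaj v = q ^ wordRmaj w * gauss q w.length b.length := by
  rcases w with _ | ⟨x, w⟩
  · simp [shuffles_nil_left, gauss_zero_left, wordRmaj_eq_zero hb, wordRmaj]
  rcases b with _ | ⟨y, b⟩
  · simp [shuffles_nil_right, gauss_zero_right]
  rw [sum_shuffles_cons_cons _ (hwb x (by simp) y (by simp)),
    (sum_wordRmaj_cons_shuffles q w (y :: b) hb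
      (fun z hz => hwb z (List.mem_cons_of_mem _ hz))).2 x (hwb x (by simp)),
    (sum_wordRmaj_cons_shuffles q (x :: w) b hb.of_cons
      (fun z hz a ha => hwb z hz a (List.mem_cons_of_mem _ ha))).1 y
      (fun z hz => hwb z hz y (by simp)) (fun z hz => List.rel_of_pairwise_cons hb hz)]
  simp only [List.length_cons, gauss_succ_succ', pow_add]
  ring

end Shuffles

section Words

/-- Words in the letters `0, …, n - 1` whose inverse has its descents in `D1` and its
left-to-right minima in `D2`. -/
def admissibleWords (D1 D2 : Finset ℕ) (n : ℕ) : Finset (List ℕ) :=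
  (List.range n).permutations.toFinset.filter fun v =>
    v.Pairwise (fun a b => b < a → ∃ d ∈ D1, b < d ∧ d ≤ a) ∧
      ∀ c, 1 ≤ c → c < n → c + 1 ∉ D2 → ¬ v.Pairwise (fun a b => b = c → c ≤ a)

theorem mem_admissibleWords {D1 D2 : Finset ℕ} {n : ℕ} {v : List ℕ} :
    v ∈ admissibleWords D1 D2 n ↔ v.Perm (List.range n) ∧
      v.Pairwise (fun a b => b < a → ∃ d ∈ D1, b < d ∧ d ≤ a) ∧
      ∀ c, 1 ≤ c → c < n → c + 1 ∉ D2 → ¬ v.Pairwise (fun a b => b = c → c ≤ a) := by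
  simp [admissibleWords, List.mem_permutations]

/-- The words extending `w` by the increasing word `b` of larger letters, where the first letter
of `b` may come first only if `allowed` holds. -/
noncomputable def extensions (allowed : Prop) (w b : List ℕ) : Finset (List ℕ) :=
  if allowed then shuffles w b else
    match w with
    | [] => ∅
    | x :: w => (shuffles w b).image (List.cons x)

theorem exists_greatest_cut (D1 : Finset ℕ) {n : ℕ} (hn : 0 < n) :
    ∃ m < n, (m = 0 ∨ m ∈ D1) ∧ ∀ d ∈ D1, d < n → d ≤ m := by
  obtain ⟨m, hm, hmax⟩ := Finset.exists_max_image (insert 0 (D1.filter (· < n))) id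
    ⟨0, by simp⟩
  simp only [Finset.mem_insert, Finset.mem_filter, id] at hm hmax
  refine ⟨m, ?_, ?_, fun d hd hdn => hmax d (Or.inr ⟨hd, hdn⟩)⟩
  · rcases hm with rfl | h
    · exact hn
    · exact h.2
  · tauto

theorem filter_lt_range (m k : ℕ) :
    (List.range (m + k)).filter (fun x => decide (x < m)) = List.range m := by
  rw [List.range_add, List.filter_append, List.filter_eq_self.2, List.filter_eq_nil_iff.2,
    List.append_nil] <;> simp

theorem filter_not_lt_range (m k : ℕ) :
    (List.range (m + k)).filter (fun x => !decide (x < m)) = List.range' m k := by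
  rw [List.range_add, List.filter_append, List.filter_eq_nil_iff.2, List.filter_eq_self.2,
    List.nil_append, List.range_eq_range', List.map_add_range', Nat.add_zero] <;> simp

theorem perm_range_iff_of_filter {m k : ℕ} {v : List ℕ}
    (h : v.filter (fun x => !decide (x < m)) = List.range' m k) :
    v.Perm (List.range (m + k)) ↔
      (v.filter (fun x => decide (x < m))).Perm (List.range m) := by
  constructor
  · intro hv
    rw [← filter_lt_range m k]
    exact hv.filter _
  · intro hv
    refine (List.filter_append_perm (fun x => decide (x < m)) v).symm.trans ?_
    rw [h]
    refine (hv.append_right _).trans ?_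
    rw [List.range_add, List.range_eq_range' (n := k), List.map_add_range', Nat.add_zero]

theorem filter_not_lt_eq_range' {D1 : Finset ℕ} {m k : ℕ} (hmax : ∀ d ∈ D1, d < m + k → d ≤ m)
    {v : List ℕ} (hv : v.Perm (List.range (m + k)))
    (hD : v.Pairwise (fun a b => b < a → ∃ d ∈ D1, b < d ∧ d ≤ a)) :
    v.filter (fun x => !decide (x < m)) = List.range' m k := by
  have hperm := hv.filter (fun x => !decide (x < m))
  rw [filter_not_lt_range] at hperm
  refine hperm.eq_of_pairwise (le := (· ≤ ·)) (fun a b _ _ h1 h2 => le_antisymm h1 h2) ?_ ?_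
  · refine (hD.filter _).imp_of_mem ?_
    intro a b ha hb h
    by_contra hab
    obtain ⟨d, hd, hbd, hda⟩ := h (by omega)
    have h1 := hperm.subset ha
    have h2 := hperm.subset hb
    rw [List.mem_range'_1] at h1 h2
    have := hmax d hd (by omega)
    omega
  · exact List.pairwise_le_range'

theorem pairwise_descent_iff {D1 : Finset ℕ} {m k : ℕ} (hm : m = 0 ∨ m ∈ D1) {v : List ℕ}
    (h : v.filter (fun x => !decide (x < m)) = List.range' m k) :
    v.Pairwise (fun a b => b < a → ∃ d ∈ D1, b < d ∧ d ≤ a) ↔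
      (v.filter (fun x => decide (x < m))).Pairwise
        (fun a b => b < a → ∃ d ∈ D1, b < d ∧ d ≤ a) := by
  refine ⟨fun hv => hv.filter _, fun hw => ?_⟩
  have hb : (v.filter (fun x => !decide (x < m))).Pairwise (· ≤ ·) := by
    rw [h]
    exact List.pairwise_le_range'
  rw [List.pairwise_filter] at hw hb
  refine (hw.and hb).imp ?_
  rintro a b ⟨h1, h2⟩ hba
  simp only [Bool.not_eq_true', decide_eq_false_iff_not, decide_eq_true_eq] at h1 h2
  by_cases ha : a < m
  · exact h1 ha (by omega) hba
  · by_cases hb : b < m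
    · exact ⟨m, by rcases hm with h | h <;> [omega; exact h], hb, by omega⟩
    · have := h2 ha hb
      omega

theorem pairwise_min_filter_iff {m c : ℕ} (hc : c < m) (v : List ℕ) :
    v.Pairwise (fun a b => b = c → c ≤ a) ↔
      (v.filter (fun x => decide (x < m))).Pairwise (fun a b => b = c → c ≤ a) := by
  rw [List.pairwise_filter]
  simp only [decide_eq_true_eq]
  refine List.Pairwise.iff ?_
  intro a b
  constructor
  · intro h _ _
    exact h
  · intro h hb
    by_cases ha : a < m
    · exact h ha (by omega) hb
    · omega

theorem not_pairwise_min_of_mem_block {m k c : ℕ} (hc : m < c) (hck : c < m + k) {v : List ℕ}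
    (h : v.filter (fun x => !decide (x < m)) = List.range' m k) :
    ¬ v.Pairwise (fun a b => b = c → c ≤ a) := by
  intro hv
  have h1 := hv.filter (fun x => !decide (x < m))
  obtain ⟨k, rfl⟩ : ∃ j, k = j + 1 := ⟨k - 1, by omega⟩
  rw [h, List.range'_succ] at h1
  have := List.rel_of_pairwise_cons h1 (a' := c) (by rw [List.mem_range'_1]; omega) rfl
  omega

theorem pairwise_min_iff_head {m k x : ℕ} {v : List ℕ} (hv : (x :: v).Nodup)
    (h : (x :: v).filter (fun x => !decide (x < m)) = List.range' m (k + 1)) :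
    (x :: v).Pairwise (fun a b => b = m → m ≤ a) ↔ ¬ x < m := by
  have hmem : m ∈ x :: v := by
    have : m ∈ (x :: v).filter (fun x => !decide (x < m)) := by
      rw [h]
      simp
    exact List.mem_of_mem_filter this
  constructor
  · intro hp hx
    rcases List.mem_cons.1 hmem with hm | hm
    · omega
    · have := List.rel_of_pairwise_cons hp hm rfl
      omega
  · intro hx
    rw [List.filter_cons, if_pos (by simpa using hx), List.range'_succ] at h
    obtain rfl : x = m := (List.cons.inj h).1
    rw [List.pairwise_cons]
    refine ⟨fun _ _ _ => le_rfl, List.Pairwise.imp_of_mem (R := fun _ _ => True) ?_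
      (List.pairwise_of_forall (by simp))⟩
    rintro a b _ hb - rfl
    exact absurd hb (List.nodup_cons.1 hv).1

theorem mem_extensions_iff {D1 D2 : Finset ℕ} {m k : ℕ}
    (hm : m = 0 ∨ m ∈ D1) (hmax : ∀ d ∈ D1, d < m + (k + 1) → d ≤ m)
    {w : List ℕ} (hw : w ∈ admissibleWords D1 D2 m) (v : List ℕ) :
    (v ∈ admissibleWords D1 D2 (m + (k + 1)) ∧ v.filter (fun x => decide (x < m)) = w) ↔
      v ∈ extensions (m = 0 ∨ m + 1 ∈ D2) w (List.range' m (k + 1)) := by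
  rw [mem_admissibleWords] at hw ⊢
  obtain ⟨hw1, hw2, hw3⟩ := hw
  have hwm : ∀ x ∈ w, decide (x < m) = true := fun x hx => by simpa using hw1.subset hx
  have hbm : ∀ y ∈ List.range' m (k + 1), decide (y < m) = false := fun y hy => by
    rw [List.mem_range'_1] at hy
    simpa using hy.1
  have base : ∀ v, v ∈ shuffles w (List.range' m (k + 1)) → v.Perm (List.range (m + (k + 1))) ∧
      v.Pairwise (fun a b => b < a → ∃ d ∈ D1, b < d ∧ d ≤ a) ∧
      ∀ c, 1 ≤ c → c < m + (k + 1) → c ≠ m → c + 1 ∉ D2 →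
        ¬ v.Pairwise (fun a b => b = c → c ≤ a) := by
    intro v hv
    rw [mem_shuffles_iff _ _ _ _ hwm hbm] at hv
    obtain ⟨h1, h2⟩ := hv
    refine ⟨?_, ?_, ?_⟩
    · rw [perm_range_iff_of_filter h2, h1]
      exact hw1
    · rw [pairwise_descent_iff hm h2, h1]
      exact hw2
    · intro c hc1 hc2 hcm hcD
      rcases lt_or_gt_of_ne hcm with hlt | hgt
      · rw [pairwise_min_filter_iff hlt, h1]
        exact hw3 c hc1 hlt hcD
      · exact not_pairwise_min_of_mem_block hgt hc2 h2
  have mem_sh : v.Perm (List.range (m + (k + 1))) →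
      v.Pairwise (fun a b => b < a → ∃ d ∈ D1, b < d ∧ d ≤ a) →
      v.filter (fun x => decide (x < m)) = w → v ∈ shuffles w (List.range' m (k + 1)) := by
    intro h1 h2 h3
    rw [mem_shuffles_iff _ _ _ _ hwm hbm]
    exact ⟨h3, filter_not_lt_eq_range' hmax h1 h2⟩
  have sh_filter : v ∈ shuffles w (List.range' m (k + 1)) →
      v.filter (fun x => decide (x < m)) = w ∧
        v.filter (fun x => !decide (x < m)) = List.range' m (k + 1) := by
    rw [mem_shuffles_iff _ _ _ _ hwm hbm]
    exact id
  unfold extensions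
  split_ifs with hall
  · constructor
    · rintro ⟨⟨h1, h2, -⟩, h3⟩
      exact mem_sh h1 h2 h3
    · intro hv
      obtain ⟨h1, h2, h3⟩ := base v hv
      refine ⟨⟨h1, h2, fun c hc1 hc2 hcD => h3 c hc1 hc2 ?_ hcD⟩, (sh_filter hv).1⟩
      rintro rfl
      rcases hall with h | h
      · omega
      · exact hcD h
  · push Not at hall
    have hlen := hw1.length_eq
    rcases w with _ | ⟨x, w⟩
    · simp at hlen
      omega
    have hx : x < m := by simpa using hwm x (by simp)
    have hsplit : ∀ u, x :: u ∈ shuffles (x :: w) (List.range' m (k + 1)) ↔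
        u ∈ shuffles w (List.range' m (k + 1)) := by
      intro u
      rw [mem_shuffles_iff _ _ _ _ hwm hbm,
        mem_shuffles_iff _ _ _ _ (fun z hz => hwm z (List.mem_cons_of_mem _ hz)) hbm]
      simp [hx]
    simp only [Finset.mem_image]
    constructor
    · rintro ⟨⟨h1, h2, h3⟩, h4⟩
      have hv := mem_sh h1 h2 h4
      have hmin := h3 m (by omega) (by omega) hall.2
      rcases v with _ | ⟨z, v⟩
      · simp at hmin
      rw [pairwise_min_iff_head (h1.nodup_iff.2 List.nodup_range) (sh_filter hv).2, not_not]
        at hmin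
      rw [List.filter_cons, if_pos (by simpa using hmin)] at h4
      obtain rfl := (List.cons.inj h4).1
      exact ⟨v, (hsplit v).1 hv, rfl⟩
    · rintro ⟨u, hu, rfl⟩
      have hv := (hsplit u).2 hu
      obtain ⟨h1, h2, h3⟩ := base _ hv
      refine ⟨⟨h1, h2, fun c hc1 hc2 hcD => ?_⟩, (sh_filter hv).1⟩
      by_cases hcm : c = m
      · rw [hcm, pairwise_min_iff_head (h1.nodup_iff.2 List.nodup_range) (sh_filter hv).2, not_not]
        exact hx
      · exact h3 c hc1 hc2 hcm hcD

variable {R : Type*} [CommRing R] (q : R)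

theorem exists_sum_extensions (allowed : Prop) (m : ℕ) (b : List ℕ) (hb : b.Pairwise (· < ·)) :
    ∃ K : R, ∀ w : List ℕ, w.length = m → (∀ x ∈ w, ∀ y ∈ b, x < y) →
      ∑ v ∈ extensions allowed w b, q ^ wordRmaj v = q ^ wordRmaj w * K ∧
      ∑ v ∈ extensions allowed w b, q ^ wordInv v = q ^ wordInv w * K := by
  by_cases ha : allowed
  · refine ⟨gauss q m b.length, ?_⟩
    rintro w rfl hwb
    unfold extensions
    rw [if_pos ha]
    exact ⟨sum_wordRmaj_shuffles q w b hb hwb, sum_wordInv_shuffles q w b hb hwb⟩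
  · rcases m with _ | m
    · refine ⟨0, fun w hw _ => ?_⟩
      obtain rfl := List.length_eq_zero_iff.1 hw
      simp [extensions, ha]
    · refine ⟨gauss q m b.length, fun w hw hwb => ?_⟩
      rcases w with _ | ⟨x, w⟩
      · simp at hw
      obtain rfl : w.length = m := by simpa using hw
      have hwb' := fun z hz => hwb z (List.mem_cons_of_mem x hz)
      rw [extensions, if_neg ha]
      rw [Finset.sum_image (fun a _ c _ h => List.cons_injective h),
        Finset.sum_image (fun a _ c _ h => List.cons_injective h)]
      refine ⟨(sum_wordRmaj_cons_shuffles q w b hb hwb').2 x (hwb x (by simp)), ?_⟩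
      have h1 : ∀ v ∈ shuffles w b, q ^ wordInv (x :: v) =
          q ^ w.countP (fun z => decide (z < x)) * q ^ wordInv v := by
        intro v hv
        rw [wordInv, pow_add, (perm_of_mem_shuffles hv).countP_eq, List.countP_append,
          (List.countP_eq_zero (l := b)).2, Nat.add_zero]
        intro z hz
        have := hwb x (by simp) z hz
        simp only [decide_eq_true_eq]
        omega
      rw [Finset.sum_congr rfl h1, ← Finset.mul_sum, sum_wordInv_shuffles q w b hb hwb', wordInv,
        pow_add, mul_assoc]

theorem sum_admissibleWords (D1 D2 : Finset ℕ) (n : ℕ) :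
    ∑ v ∈ admissibleWords D1 D2 n, q ^ wordRmaj v =
      ∑ v ∈ admissibleWords D1 D2 n, q ^ wordInv v := by
  induction n using Nat.strong_induction_on with
  | _ n ih =>
    rcases Nat.eq_zero_or_pos n with rfl | hn
    · refine Finset.sum_congr rfl fun v hv => ?_
      have := (mem_admissibleWords.1 hv).1
      simp only [List.range_zero, List.perm_nil] at this
      simp [this, wordRmaj, wordInv]
    obtain ⟨m, hmn, hm, hmax⟩ := exists_greatest_cut D1 hn
    obtain ⟨k, rfl⟩ : ∃ k, n = m + (k + 1) := ⟨n - m - 1, by omega⟩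
    obtain ⟨K, hK⟩ := exists_sum_extensions q (m = 0 ∨ m + 1 ∈ D2) m (List.range' m (k + 1))
      List.pairwise_lt_range'
    have hmaps : ∀ v ∈ admissibleWords D1 D2 (m + (k + 1)),
        v.filter (fun x => decide (x < m)) ∈ admissibleWords D1 D2 m := by
      intro v hv
      rw [mem_admissibleWords] at hv ⊢
      obtain ⟨h1, h2, h3⟩ := hv
      refine ⟨?_, h2.filter _, fun c hc1 hc2 hcD => ?_⟩
      · rw [← filter_lt_range m (k + 1)]
        exact h1.filter _
      · rw [← pairwise_min_filter_iff hc2]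
        exact h3 c hc1 (by omega) hcD
    have hfiber : ∀ w ∈ admissibleWords D1 D2 m,
        (admissibleWords D1 D2 (m + (k + 1))).filter
          (fun v => v.filter (fun x => decide (x < m)) = w) =
        extensions (m = 0 ∨ m + 1 ∈ D2) w (List.range' m (k + 1)) := by
      intro w hw
      ext v
      rw [Finset.mem_filter]
      exact mem_extensions_iff hm hmax hw v
    have hsum : ∀ w ∈ admissibleWords D1 D2 m,
        ∑ v ∈ extensions (m = 0 ∨ m + 1 ∈ D2) w (List.range' m (k + 1)), q ^ wordRmaj v =
          q ^ wordRmaj w * K ∧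
        ∑ v ∈ extensions (m = 0 ∨ m + 1 ∈ D2) w (List.range' m (k + 1)), q ^ wordInv v =
          q ^ wordInv w * K := by
      intro w hw
      have hp := (mem_admissibleWords.1 hw).1
      refine hK w (by simpa using hp.length_eq) fun x hx y hy => ?_
      have h1 := hp.subset hx
      rw [List.mem_range] at h1
      rw [List.mem_range'_1] at hy
      omega
    rw [← Finset.sum_fiberwise_of_maps_to hmaps, ← Finset.sum_fiberwise_of_maps_to hmaps]
    calc _ = ∑ w ∈ admissibleWords D1 D2 m, q ^ wordRmaj w * K :=
          Finset.sum_congr rfl fun w hw => by rw [hfiber w hw, (hsum w hw).1]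
      _ = ∑ w ∈ admissibleWords D1 D2 m, q ^ wordInv w * K := by
          rw [← Finset.sum_mul, ← Finset.sum_mul, ih m hmn]
      _ = _ := Finset.sum_congr rfl fun w hw => by rw [hfiber w hw, (hsum w hw).2]

end Words

section PermToWord

theorem countP_ofFn {n : ℕ} (f : Fin n → ℕ) (p : ℕ → Bool) :
    (List.ofFn f).countP p = ∑ i, if p (f i) then 1 else 0 := by
  induction n with
  | zero => simp
  | succ n ih => rw [List.ofFn_succ, List.countP_cons, ih, Fin.sum_univ_succ, add_comm]

theorem wordInv_ofFn {n : ℕ} (f : Fin n → ℕ) :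
    wordInv (List.ofFn f) =
      (Finset.univ.filter fun p : Fin n × Fin n => p.1 < p.2 ∧ f p.2 < f p.1).card := by
  rw [Finset.card_filter, Fintype.sum_prod_type]
  induction n with
  | zero => simp [wordInv]
  | succ n ih =>
    rw [List.ofFn_succ, wordInv, ih, countP_ofFn, Fin.sum_univ_succ]
    simp only [Fin.sum_univ_succ, lt_irrefl, Fin.succ_pos, Fin.not_lt_zero, Fin.succ_lt_succ_iff,
      true_and, false_and, if_false, Nat.zero_add, decide_eq_true_eq]

theorem wordRmaj_eq_sum (l : List ℕ) :
    wordRmaj l = ∑ i ∈ Finset.range (l.length - 1),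
      if l.getD (i + 1) 0 < l.getD i 0 then l.length - (1 + i) else 0 := by
  induction l with
  | nil => rfl
  | cons x l ih =>
    rcases l with _ | ⟨y, l⟩
    · rfl
    · rw [wordRmaj, ih]
      simp only [List.length_cons, Nat.add_sub_cancel]
      rw [Finset.sum_range_succ', add_comm]
      congr 1
      refine Finset.sum_congr rfl fun i _ => ?_
      simp only [List.getD_cons_succ]
      congr 1
      omega

/-- The one-line notation of a permutation. -/
def permWord {n : ℕ} (π : Equiv.Perm (Fin n)) : List ℕ :=
  List.ofFn fun i => (π i : ℕ)

theorem wordInv_permWord {n : ℕ} (π : Equiv.Perm (Fin n)) : wordInv (permWord π) = invS π := by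
  rw [permWord, wordInv_ofFn, invS]
  simp only [Fin.val_fin_lt]

theorem wordRmaj_permWord {n : ℕ} (π : Equiv.Perm (Fin n)) :
    wordRmaj (permWord π) = rmaj1 n π := by
  rw [wordRmaj_eq_sum, rmaj1, Des1, Finset.sum_filter, Finset.sum_Ico_eq_sum_range]
  simp only [permWord, List.length_ofFn]
  refine Finset.sum_congr rfl fun i hi => ?_
  rw [Finset.mem_range] at hi
  have h1 : 1 + i < n := by omega
  refine if_congr ?_ rfl rfl
  rw [List.getD_eq_getElem _ _ (by simp; omega), List.getD_eq_getElem _ _ (by simp; omega)]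
  simp only [List.getElem_ofFn, Fin.val_fin_lt, h1, exists_true_left, Nat.add_sub_cancel_left,
    Nat.add_comm i 1]

theorem permWord_injective {n : ℕ} :
    Function.Injective (permWord : Equiv.Perm (Fin n) → List ℕ) := by
  intro π σ h
  ext i
  exact congrFun (List.ofFn_injective h) i

theorem permWord_perm_range {n : ℕ} (π : Equiv.Perm (Fin n)) :
    (permWord π).Perm (List.range n) := by
  refine (List.perm_ext_iff_of_nodup ?_ List.nodup_range).2 fun a => ?_
  · exact List.nodup_ofFn.2 (Fin.val_injective.comp π.injective)
  · rw [permWord, List.mem_ofFn, List.mem_range]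
    constructor
    · rintro ⟨i, rfl⟩
      exact (π i).2
    · intro ha
      exact ⟨π.symm ⟨a, ha⟩, by simp⟩

theorem exists_permWord_eq {n : ℕ} {v : List ℕ} (hv : v.Perm (List.range n)) :
    ∃ π : Equiv.Perm (Fin n), permWord π = v := by
  obtain rfl : v.length = n := by simpa using hv.length_eq
  have hlt : ∀ i : Fin v.length, v[i] < v.length := fun i =>
    List.mem_range.1 (hv.subset (List.getElem_mem i.2))
  have hinj : Function.Injective fun i : Fin v.length => (⟨v[i], hlt i⟩ : Fin v.length) := by
    intro i j h
    have h' : v[(i : ℕ)] = v[(j : ℕ)] := congrArg Fin.val h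
    exact Fin.ext ((hv.nodup_iff.2 List.nodup_range).getElem_inj_iff.1 h')
  refine ⟨Equiv.ofBijective _ (Finite.injective_iff_bijective.1 hinj), ?_⟩
  exact List.ofFn_getElem

theorem Des1_inv_subset_iff {n : ℕ} (D1 : Finset ℕ) (π : Equiv.Perm (Fin n)) :
    Des1 π⁻¹ ⊆ D1 ↔
      (permWord π).Pairwise fun a b => b < a → ∃ d ∈ D1, b < d ∧ d ≤ a := by
  rw [permWord, List.pairwise_ofFn]
  constructor
  · intro h
    have step : ∀ t b : ℕ, ∀ (hb : b < n) (ha : b + t < n), (∀ d ∈ D1, b < d → b + t < d) →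
        π⁻¹ ⟨b, hb⟩ ≤ π⁻¹ ⟨b + t, ha⟩ := by
      intro t
      induction t with
      | zero => intro b hb _ _; exact le_rfl
      | succ t ih =>
        intro b hb ha hd
        refine (ih b hb (by omega) fun d hd1 hd2 => ?_).trans ?_
        · have := hd d hd1 hd2
          omega
        · by_contra! hlt
          have hmem : b + (t + 1) ∈ Des1 π⁻¹ := by
            rw [Des1, Finset.mem_filter, Finset.mem_Ico]
            exact ⟨⟨by omega, ha⟩, ha, hlt⟩
          have := hd _ (h hmem) (by omega)
          omega
    intro i j hij hlt
    by_contra! hd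
    have hs := step ((π i : ℕ) - π j) (π j) (π j).2 (by have := (π i).2; omega)
      (fun d hd1 hd2 => by have := hd d hd1 hd2; omega)
    have he : (⟨(π j : ℕ) + ((π i : ℕ) - π j), by have := (π i).2; omega⟩ : Fin n) = π i :=
      Fin.ext (by simp only; omega)
    rw [he] at hs
    simp only [Fin.eta, Equiv.Perm.inv_def, Equiv.symm_apply_apply] at hs
    exact absurd hij (not_lt.2 hs)
  · intro h d hd
    rw [Des1, Finset.mem_filter, Finset.mem_Ico] at hd
    obtain ⟨⟨hd1, -⟩, hdn, hlt⟩ := hd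
    have := h hlt
    simp only [Equiv.Perm.inv_def, Equiv.apply_symm_apply] at this
    obtain ⟨e, he, h1, h2⟩ := this (by omega)
    obtain rfl : e = d := by omega
    exact he

theorem DelSet_inv_subset_iff {n : ℕ} (D2 : Finset ℕ) (π : Equiv.Perm (Fin n)) :
    DelSet π⁻¹ ⊆ D2 ↔ ∀ c, 1 ≤ c → c < n → c + 1 ∉ D2 →
      ¬ (permWord π).Pairwise fun a b => b = c → c ≤ a := by
  have key : ∀ c (_ : 1 ≤ c) (hc : c < n), c + 1 ∈ DelSet π⁻¹ ↔
      (permWord π).Pairwise fun a b => b = c → c ≤ a := by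
    intro c hc1 hc
    rw [permWord, List.pairwise_ofFn, DelSet, Finset.mem_filter, Finset.mem_Icc]
    simp only [Nat.add_sub_cancel]
    constructor
    · rintro ⟨-, _, h⟩ i j hij rfl
      by_contra! hlt
      have := h (π i) hlt
      simp only [Fin.eta, Equiv.Perm.inv_def, Equiv.symm_apply_apply] at this
      exact absurd hij (not_lt.2 this.le)
    · intro h
      refine ⟨by omega, hc, fun j hj => ?_⟩
      by_contra! hle
      have hne : π⁻¹ j ≠ π⁻¹ ⟨c, hc⟩ := fun he => by
        have := congrArg Fin.val (π⁻¹.injective he)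
        simp only at this
        omega
      have := h (lt_of_le_of_ne hle hne)
      simp only [Equiv.Perm.inv_def, Equiv.apply_symm_apply, forall_const] at this
      omega
  constructor
  · intro h c hc1 hc hcD hp
    exact hcD (h ((key c hc1 hc).2 hp))
  · intro h d hd
    have hd' := hd
    rw [DelSet, Finset.mem_filter, Finset.mem_Icc] at hd'
    obtain ⟨⟨hd1, hd2⟩, -⟩ := hd'
    obtain ⟨c, rfl⟩ : ∃ c, d = c + 1 := ⟨d - 1, by omega⟩
    by_contra hcD
    exact h c (by omega) (by omega) hcD ((key c (by omega) (by omega)).1 hd)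

theorem sum_permWord {M : Type*} [AddCommMonoid M] (n : ℕ) (D1 D2 : Finset ℕ)
    (f : List ℕ → M) :
    ∑ π ∈ Finset.univ.filter
        (fun π : Equiv.Perm (Fin n) => Des1 π⁻¹ ⊆ D1 ∧ DelSet π⁻¹ ⊆ D2), f (permWord π) =
      ∑ v ∈ admissibleWords D1 D2 n, f v := by
  refine Finset.sum_bij (fun π _ => permWord π) ?_ (fun _ _ _ _ h => permWord_injective h) ?_
    (fun _ _ => rfl)
  · intro π hπ
    rw [Finset.mem_filter, Des1_inv_subset_iff, DelSet_inv_subset_iff] at hπ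
    exact mem_admissibleWords.2 ⟨permWord_perm_range π, hπ.2⟩
  · intro v hv
    rw [mem_admissibleWords] at hv
    obtain ⟨π, rfl⟩ := exists_permWord_eq hv.1
    refine ⟨π, ?_, rfl⟩
    rw [Finset.mem_filter, Des1_inv_subset_iff, DelSet_inv_subset_iff]
    exact ⟨Finset.mem_univ _, hv.2⟩

end PermToWord

/-- For all `D₁ ⊆ [n-1]`, `D₂ ⊆ [n]` :
`∑ q^{rmaj_{S_n}(π)} = ∑ q^{ℓ_S(π)}` over `{π : Des_S(π⁻¹) ⊆ D₁, Del_S(π⁻¹) ⊆ D₂}`. -/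
theorem stmt18 (n : ℕ) (D1 D2 : Finset ℕ) (hD1 : D1 ⊆ Finset.Icc 1 (n - 1))
    (hD2 : D2 ⊆ Finset.Icc 1 n) (R : Type*) [CommRing R] (q : R) :
    ∑ π ∈ Finset.univ.filter
        (fun π : Equiv.Perm (Fin n) => Des1 π⁻¹ ⊆ D1 ∧ DelSet π⁻¹ ⊆ D2),
        q ^ rmaj1 n π =
      ∑ π ∈ Finset.univ.filter
        (fun π : Equiv.Perm (Fin n) => Des1 π⁻¹ ⊆ D1 ∧ DelSet π⁻¹ ⊆ D2),
        q ^ invS π := by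
  simp only [← wordRmaj_permWord, ← wordInv_permWord]
  rw [sum_permWord n D1 D2 fun v => q ^ wordRmaj v, sum_permWord n D1 D2 fun v => q ^ wordInv v]
  exact sum_admissibleWords q D1 D2 n
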